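/- Let Λ be a row-finite k-graph with no sources and TG_Λ the path groupoid with unit space W_Λ (all finite and infinite paths), morphisms (x, m, y) with σ^p x = σ^q y for some p ≤ d(x), q ≤ d(y), p - q = m. Then TG_Λ is effective: the interior of the isotropy Iso(TG_Λ) = {a : s(a) = r(a)} equals the unit space TG_Λ^{(0)}. -/

import Mathlib

/-- A higher-rank graph (`k`-graph): a small category with a degree functor to `ℕ^k`
satisfying the factorisation property.  Paths and vertices live in one type `Path`;
vertices are the paths of degree `0`. Composition is a total function which is only
meaningful on composable pairs. -/
structure KGraph (k : ℕ) where
  Path : Type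
  src : Path → Path
  rng : Path → Path
  comp : Path → Path → Path
  deg : Path → Fin k → ℕ
  deg_src : ∀ a, deg (src a) = 0
  deg_rng : ∀ a, deg (rng a) = 0
  src_vertex : ∀ a, deg a = 0 → src a = a
  rng_vertex : ∀ a, deg a = 0 → rng a = a
  comp_assoc : ∀ a b c, src a = rng b → src b = rng c →
    comp (comp a b) c = comp a (comp b c)
  rng_comp : ∀ a b, src a = rng b → rng (comp a b) = rng a
  src_comp : ∀ a b, src a = rng b → src (comp a b) = src b
  deg_comp : ∀ a b, src a = rng b → deg (comp a b) = deg a + deg b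
  comp_rng_self : ∀ a, comp (rng a) a = a
  comp_src_self : ∀ a, comp a (src a) = a
  factor : ∀ a (m n : Fin k → ℕ), deg a = m + n →
    ∃! p : Path × Path, src p.1 = rng p.2 ∧ comp p.1 p.2 = a ∧
      deg p.1 = m ∧ deg p.2 = n

namespace KGraph

variable {k : ℕ}

/-- `v` is a vertex iff it has degree `0`. -/
def IsVertex (Λ : KGraph k) (v : Λ.Path) : Prop := Λ.deg v = 0

/-- The set `vΛ¹` of edges (paths of degree `e_i` for some `i`) with range `v`. -/
def edgesAt (Λ : KGraph k) (v : Λ.Path) : Set Λ.Path :=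
  {e | Λ.rng e = v ∧ ∃ i : Fin k, Λ.deg e = Pi.single i 1}

/-- `Λ` is row-finite: each vertex receives finitely many edges. -/
def RowFinite (Λ : KGraph k) : Prop := ∀ v, (Λ.edgesAt v).Finite

/-- `Λ` has no sources: `vΛ^m ≠ ∅` for every vertex `v` and every `m ∈ ℕ^k`. -/
def NoSources (Λ : KGraph k) : Prop :=
  ∀ v, Λ.IsVertex v → ∀ m : Fin k → ℕ, ∃ a, Λ.rng a = v ∧ Λ.deg a = m

/-- `MCE(l, m)`: minimal common extensions of `l` and `m`. -/
def MCE (Λ : KGraph k) (l m : Λ.Path) : Set Λ.Path :=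
  {t | Λ.deg t = Λ.deg l ⊔ Λ.deg m ∧
    (∃ ν, Λ.src l = Λ.rng ν ∧ Λ.comp l ν = t) ∧
    (∃ γ, Λ.src m = Λ.rng γ ∧ Λ.comp m γ = t)}

/-- `Λ^min(l, m)`: pairs `(ν, γ)` with `lν = mγ ∈ MCE(l, m)`. -/
def MinPairs (Λ : KGraph k) (l m : Λ.Path) : Set (Λ.Path × Λ.Path) :=
  {p | Λ.src l = Λ.rng p.1 ∧ Λ.src m = Λ.rng p.2 ∧
    Λ.comp l p.1 = Λ.comp m p.2 ∧ Λ.comp l p.1 ∈ Λ.MCE l m}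

/-- `E ⊆ vΛ` is exhaustive if every path with range `v` has a common extension with
some member of `E`. -/
def IsExhaustive (Λ : KGraph k) (v : Λ.Path) (E : Set Λ.Path) : Prop :=
  ∀ a, Λ.rng a = v → ∃ μ ∈ E, (Λ.MinPairs a μ).Nonempty

end KGraph

/-- A Cohn `Λ`-family in a ring `A` : relations (CP1)–(CP3). -/
structure IsCohnFamily {k : ℕ} (Λ : KGraph k) (A : Type) [Ring A]
    (T Ts : Λ.Path → A) : Prop where
  ghost_vertex : ∀ v, Λ.IsVertex v → Ts v = T v
  vertex_idem : ∀ v, Λ.IsVertex v → T v * T v = T v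
  vertex_orth : ∀ v w, Λ.IsVertex v → Λ.IsVertex w → v ≠ w → T v * T w = 0
  mul_comp : ∀ a b, Λ.src a = Λ.rng b → T a * T b = T (Λ.comp a b)
  ghost_mul_comp : ∀ a b, Λ.src a = Λ.rng b → Ts b * Ts a = Ts (Λ.comp a b)
  cp3 : ∀ a b, Ts a * T b = ∑ᶠ p ∈ Λ.MinPairs a b, T p.1 * Ts p.2

/-- Product of the images of the elements of a finset, in some fixed enumeration.
(The products we take are over pairwise-commuting factors, so the order is immaterial.) -/
noncomputable def listProd {A : Type} [Monoid A] {ι : Type} (s : Finset ι) (f : ι → A) : A :=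
  (s.toList.map f).prod

/-- `F_{T,v} := T_v - ∏_{e ∈ vΛ¹} (T_v - T_e T_{e*})`. -/
noncomputable def FF {k : ℕ} (Λ : KGraph k) (hrf : Λ.RowFinite) {A : Type} [Ring A]
    (T Ts : Λ.Path → A) (v : Λ.Path) : A :=
  T v - listProd (hrf v).toFinset (fun e => T v - T e * Ts e)

/-- The path space `W_Λ` of a `k`-graph `Λ`: the set of all (finite and infinite)
paths, i.e. degree-preserving functors `x : Ω_{k,n} → Λ` for `n ∈ (ℕ∪{∞})^k`,
presented by its structural operations: range `rW`, degree `dW : W → (ℕ∪{∞})^k`,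
concatenation `cons λ x = λx` (for `s(λ) = r(x)`), shift `σ^n x`, initial segment
`seg x n = x(0,n)` (for `n ≤ d(x)`), and the embedding `ofPath` of finite paths. -/
structure PathSpace {k : ℕ} (Λ : KGraph k) where
  W : Type
  rW : W → Λ.Path
  dW : W → Fin k → ℕ∞
  rW_vertex : ∀ x, Λ.IsVertex (rW x)
  cons : Λ.Path → W → W
  shift : (Fin k → ℕ) → W → W
  seg : W → (Fin k → ℕ) → Λ.Path
  ofPath : Λ.Path → W
  rW_cons : ∀ a x, Λ.src a = rW x → rW (cons a x) = Λ.rng a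
  dW_cons : ∀ a x, Λ.src a = rW x →
    dW (cons a x) = fun i => (Λ.deg a i : ℕ∞) + dW x i
  cons_vertex : ∀ v x, Λ.IsVertex v → v = rW x → cons v x = x
  cons_comp : ∀ a b x, Λ.src a = Λ.rng b → Λ.src b = rW x →
    cons (Λ.comp a b) x = cons a (cons b x)
  seg_deg : ∀ x n, (∀ i, (n i : ℕ∞) ≤ dW x i) → Λ.deg (seg x n) = n
  seg_rng : ∀ x n, (∀ i, (n i : ℕ∞) ≤ dW x i) → Λ.rng (seg x n) = rW x
  seg_zero : ∀ x, seg x 0 = rW x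
  cons_seg_shift : ∀ x n, (∀ i, (n i : ℕ∞) ≤ dW x i) →
    cons (seg x n) (shift n x) = x
  rW_shift : ∀ x n, (∀ i, (n i : ℕ∞) ≤ dW x i) → rW (shift n x) = Λ.src (seg x n)
  dW_shift : ∀ x n, (∀ i, (n i : ℕ∞) ≤ dW x i) →
    dW (shift n x) = fun i => dW x i - (n i : ℕ∞)
  shift_zero : ∀ x, shift 0 x = x
  shift_shift : ∀ x m n, (∀ i, ((m i + n i : ℕ) : ℕ∞) ≤ dW x i) →
    shift n (shift m x) = shift (m + n) x
  seg_cons : ∀ a x, Λ.src a = rW x → seg (cons a x) (Λ.deg a) = a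
  shift_cons : ∀ a x, Λ.src a = rW x → shift (Λ.deg a) (cons a x) = x
  rW_ofPath : ∀ a, rW (ofPath a) = Λ.rng a
  dW_ofPath : ∀ a, dW (ofPath a) = fun i => (Λ.deg a i : ℕ∞)
  seg_ofPath : ∀ a, seg (ofPath a) (Λ.deg a) = a

open scoped Classical

/-- The endomorphism `T_λ` of the free module `𝔽_R(W_Λ)`:
`T_λ(x) = λx` if `s(λ) = r(x)` and `0` otherwise (for a vertex `v` this is
`T_v(x) = x` if `r(x) = v` and `0` otherwise). -/
noncomputable def repT {k : ℕ} {Λ : KGraph k} (P : PathSpace Λ) (R : Type)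
    [CommRing R] (a : Λ.Path) : Module.End R (P.W →₀ R) :=
  Finsupp.lsum R fun x =>
    if Λ.src a = P.rW x then (Finsupp.lsingle (P.cons a x) : R →ₗ[R] (P.W →₀ R))
    else 0

/-- The endomorphism `T_{μ*}` of the free module `𝔽_R(W_Λ)`:
`T_{μ*}(x) = σ^{d(μ)} x` if `x(0, d(μ)) = μ` and `0` otherwise. -/
noncomputable def repTs {k : ℕ} {Λ : KGraph k} (P : PathSpace Λ) (R : Type)
    [CommRing R] (a : Λ.Path) : Module.End R (P.W →₀ R) :=
  Finsupp.lsum R fun x =>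
    if (∀ i, (Λ.deg a i : ℕ∞) ≤ P.dW x i) ∧ P.seg x (Λ.deg a) = a then
      (Finsupp.lsingle (P.shift (Λ.deg a) x) : R →ₗ[R] (P.W →₀ R))
    else 0

section PathGroupoid

variable {k : ℕ} (Λ : KGraph k) (P : PathSpace Λ)

/-- A morphism of the path groupoid `TG_Λ` is a triple `(x, m, y)` with
`σ^p x = σ^q y` for some `p ≤ d(x)`, `q ≤ d(y)` with `p - q = m`. -/
def IsMor (a : P.W × (Fin k → ℤ) × P.W) : Prop :=
  ∃ p q : Fin k → ℕ,
    (∀ i, (p i : ℕ∞) ≤ P.dW a.1 i) ∧ (∀ i, (q i : ℕ∞) ≤ P.dW a.2.2 i) ∧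
    (∀ i, (p i : ℤ) - (q i : ℤ) = a.2.1 i) ∧ P.shift p a.1 = P.shift q a.2.2

/-- The path groupoid `TG_Λ`: the set of morphism triples `(x, m, y)`. -/
def TG : Type := {a : P.W × (Fin k → ℤ) × P.W // IsMor Λ P a}

/-- The basic compact open bisection `TZ_Λ(λ *_s μ \ G)`: triples
`(λz, d(λ) - d(μ), μz)` with `z ∈ s(λ)W_Λ` not extending through any `ν ∈ G`. -/
def TZ (l m : Λ.Path) (G : Finset Λ.Path) : Set (TG Λ P) :=
  {a | ∃ z : P.W, Λ.src l = P.rW z ∧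
    a.1.1 = P.cons l z ∧ a.1.2.2 = P.cons m z ∧
    (∀ i, a.1.2.1 i = (Λ.deg l i : ℤ) - (Λ.deg m i : ℤ)) ∧
    ∀ ν ∈ G, ¬((∀ i, (Λ.deg ν i : ℕ∞) ≤ P.dW z i) ∧ P.seg z (Λ.deg ν) = ν)}

/-- The topology on `TG_Λ` generated by the basic sets `TZ_Λ(λ *_s μ \ G)`
for `s(λ) = s(μ)` and finite `G ⊆ s(λ)Λ`. -/
def TGTopology : TopologicalSpace (TG Λ P) :=
  TopologicalSpace.generateFrom
    {S | ∃ (l m : Λ.Path) (G : Finset Λ.Path),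
      Λ.src l = Λ.src m ∧ (∀ ν ∈ G, Λ.rng ν = Λ.src l) ∧ S = TZ Λ P l m G}

end PathGroupoid

theorem aux_split {k : ℕ} {Λ : KGraph k} (P : PathSpace Λ) (l : Λ.Path) (z : P.W)
    (n : Fin k → ℕ) (h : Λ.src l = P.rW z) (hn : ∀ i, (n i : ℕ∞) ≤ P.dW z i) :
    Λ.src l = Λ.rng (P.seg z n) ∧
    P.seg (P.cons l z) (Λ.deg l + n) = Λ.comp l (P.seg z n) ∧
    P.shift (Λ.deg l + n) (P.cons l z) = P.shift n z := by
  have h1 : Λ.src l = Λ.rng (P.seg z n) := by rw [P.seg_rng z n hn, h]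
  have h2 : Λ.src (P.seg z n) = P.rW (P.shift n z) := (P.rW_shift z n hn).symm
  have h3 : P.cons l z = P.cons (Λ.comp l (P.seg z n)) (P.shift n z) := by
    rw [P.cons_comp _ _ _ h1 h2, P.cons_seg_shift z n hn]
  have h4 : Λ.deg (Λ.comp l (P.seg z n)) = Λ.deg l + n := by
    rw [Λ.deg_comp _ _ h1, P.seg_deg z n hn]
  have h5 : Λ.src (Λ.comp l (P.seg z n)) = P.rW (P.shift n z) := by
    rw [Λ.src_comp _ _ h1, h2]
  refine ⟨h1, ?_, ?_⟩
  · rw [h3, ← h4, P.seg_cons _ _ h5]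
  · rw [h3, ← h4, P.shift_cons _ _ h5]

/-- The initial segments of `te` of degree at most `d(t)` do not depend on `e`. -/
theorem aux_seg {k : ℕ} {Λ : KGraph k} (P : PathSpace Λ) (t : Λ.Path) (e f : P.W)
    (r : Fin k → ℕ) (he : Λ.src t = P.rW e) (hf : Λ.src t = P.rW f)
    (hr : ∀ i, r i ≤ Λ.deg t i) :
    P.seg (P.cons t e) r = P.seg (P.cons t f) r := by
  obtain ⟨⟨a, b⟩, ⟨hab, hc, ha, hb⟩, -⟩ := Λ.factor t r (Λ.deg t - r) (by
    funext i; have := hr i; simp; omega)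
  simp only at hab hc ha hb
  have hs : Λ.src t = Λ.src b := by rw [← hc, Λ.src_comp _ _ hab]
  have key : ∀ g : P.W, Λ.src t = P.rW g → P.seg (P.cons t g) r = a := by
    intro g hg
    rw [hs] at hg
    rw [← hc, P.cons_comp _ _ _ hab hg, ← ha]
    exact P.seg_cons _ _ (by rw [P.rW_cons _ _ hg, hab])
  rw [key e he, key f hf]

theorem aux_open {k : ℕ} (Λ : KGraph k) (P : PathSpace Λ) (a : TG Λ P)
    (haa : a.1.1 = a.1.2.2) (U : Set (TG Λ P))
    (hU : TopologicalSpace.GenerateOpen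
      {S | ∃ (l m : Λ.Path) (G : Finset Λ.Path),
        Λ.src l = Λ.src m ∧ (∀ ν ∈ G, Λ.rng ν = Λ.src l) ∧ S = TZ Λ P l m G} U)
    (haU : a ∈ U) :
    ∃ N₀ : Fin k → ℕ, (∀ i, (N₀ i : ℕ∞) ≤ P.dW a.1.1 i) ∧
      ∀ N N' : Fin k → ℕ, (∀ i, N₀ i ≤ N i) → (∀ i, (N i : ℕ∞) ≤ P.dW a.1.1 i) →
        (∀ i, (N i : ℤ) - (N' i : ℤ) = a.1.2.1 i) →
        ∀ (e : P.W) (b : TG Λ P), P.rW e = P.rW (P.shift N a.1.1) → P.dW e = 0 →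
          b.1.1 = P.cons (P.seg a.1.1 N) e → b.1.2.2 = P.cons (P.seg a.1.1 N') e →
          b.1.2.1 = a.1.2.1 → b ∈ U := by
  induction hU with
  | univ => exact ⟨0, fun i => by simp, fun _ _ _ _ _ _ _ _ _ _ _ _ => trivial⟩
  | inter s t _ _ ihs iht =>
    obtain ⟨A, hA, hA'⟩ := ihs haU.1
    obtain ⟨B, hB, hB'⟩ := iht haU.2
    refine ⟨A ⊔ B, fun i => ?_, ?_⟩
    · rcases le_total (A i) (B i) with h | h
      · simpa [h] using hB i
      · simpa [h] using hA i
    · intro N N' h1 h2 h3 e b h4 h5 h6 h7 h8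
      exact ⟨hA' N N' (fun i => le_trans (by simp) (h1 i)) h2 h3 e b h4 h5 h6 h7 h8,
        hB' N N' (fun i => le_trans (by simp) (h1 i)) h2 h3 e b h4 h5 h6 h7 h8⟩
  | sUnion S _ ih =>
    obtain ⟨s, hs, has⟩ := haU
    obtain ⟨A, hA, hA'⟩ := ih s hs has
    exact ⟨A, hA, fun N N' h1 h2 h3 e b h4 h5 h6 h7 h8 =>
      ⟨s, hs, hA' N N' h1 h2 h3 e b h4 h5 h6 h7 h8⟩⟩
  | basic s hs =>
    obtain ⟨l, m, G, hlm, hG, rfl⟩ := hs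
    obtain ⟨z, hz, hx, hy, hd, hz'⟩ := haU
    have hdx : ∀ i, P.dW a.1.1 i = (Λ.deg l i : ℕ∞) + P.dW z i := by
      intro i; rw [hx, P.dW_cons _ _ hz]
    refine ⟨Λ.deg l, fun i => by rw [hdx]; exact le_self_add, ?_⟩
    intro N N' h1 h2 h3 e b h4 h5 h6 h7 h8
    obtain ⟨n, rfl⟩ : ∃ n, N = Λ.deg l + n :=
      ⟨N - Λ.deg l, by funext i; have := h1 i; simp; omega⟩
    obtain rfl : N' = Λ.deg m + n := by
      funext i
      have e1 := h3 i
      have e2 := hd i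
      simp only [Pi.add_apply] at e1 ⊢
      push_cast at e1
      omega
    have hn : ∀ i, (n i : ℕ∞) ≤ P.dW z i := by
      intro i
      have := h2 i
      rw [hdx] at this
      simp only [Pi.add_apply, Nat.cast_add] at this
      exact (ENat.add_le_add_iff_left (ENat.natCast_ne_top _)).1 this
    obtain ⟨c1, c2, c3⟩ := aux_split P l z n hz hn
    obtain ⟨d1, d2, d3⟩ := aux_split P m z n (hlm ▸ hz) hn
    rw [hx, c3] at h4
    have hse : Λ.src (P.seg z n) = P.rW e := by rw [h4, P.rW_shift z n hn]
    refine ⟨P.cons (P.seg z n) e, ?_, ?_, ?_, ?_, ?_⟩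
    · rw [P.rW_cons _ _ hse, c1]
    · rw [h6, hx, c2, P.cons_comp _ _ _ c1 hse]
    · rw [h7, haa, hy, d2, P.cons_comp _ _ _ d1 hse]
    · rw [h8]; exact hd
    · rintro ν hν ⟨g1, g2⟩
      have g3 : ∀ i, Λ.deg ν i ≤ n i := by
        intro i
        have := g1 i
        rw [P.dW_cons _ _ hse, h5, P.seg_deg z n hn] at this
        simpa using this
      refine hz' ν hν ⟨fun i => le_trans (by exact_mod_cast g3 i) (hn i), ?_⟩
      rw [aux_seg P _ e (P.shift n z) _ hse (P.rW_shift z n hn).symm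
        (by rw [P.seg_deg z n hn]; exact g3), P.cons_seg_shift z n hn] at g2
      exact g2

/-- Proposition: for a row-finite `k`-graph `Λ` with no sources, the path groupoid
`TG_Λ` is effective: the interior of the isotropy
`Iso(TG_Λ) = {(x,m,y) : x = y}` is the unit space `{(x,0,x)}`. -/
theorem path_groupoid_effective {k : ℕ} (Λ : KGraph k)
    (hrf : Λ.RowFinite) (hns : Λ.NoSources) (P : PathSpace Λ) :
    @interior (TG Λ P) (TGTopology Λ P) {a | a.1.1 = a.1.2.2} =
      {a : TG Λ P | a.1.1 = a.1.2.2 ∧ a.1.2.1 = 0} := by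
  letI := TGTopology Λ P
  apply Set.Subset.antisymm
  · intro a ha
    have ha1 := interior_subset ha
    have haa : a.1.1 = a.1.2.2 := ha1
    have hop : IsOpen (interior {a : TG Λ P | a.1.1 = a.1.2.2}) := isOpen_interior
    refine ⟨haa, ?_⟩
    obtain ⟨A, hA, hA'⟩ := aux_open Λ P a haa _ hop ha
    obtain ⟨p, q, hp, hq, hpq, hs⟩ := a.2
    rw [← haa] at hq hs
    have hN : ∀ i, (((p ⊔ A) i : ℕ) : ℕ∞) ≤ P.dW a.1.1 i := by
      intro i
      rcases le_total (A i) (p i) with h | h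
      · simpa [h] using hp i
      · simpa [h] using hA i
    obtain ⟨n, hn⟩ : ∃ n, p ⊔ A = p + n :=
      ⟨(p ⊔ A) - p, by funext i; simp⟩
    have hAN : ∀ i, A i ≤ (p + n) i := fun i => by rw [← hn]; simp
    rw [hn] at hN
    have hnz : ∀ i, (n i : ℕ∞) ≤ P.dW (P.shift p a.1.1) i := by
      intro i
      rw [P.dW_shift _ _ hp]
      have := hN i
      simp only [Pi.add_apply, Nat.cast_add] at this
      exact ENat.le_sub_of_add_le_left (ENat.natCast_ne_top _) this
    have hN' : ∀ i, (((q + n) i : ℕ) : ℕ∞) ≤ P.dW a.1.1 i := by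
      intro i
      have := hnz i
      rw [hs, P.dW_shift _ _ hq] at this
      simp only [Pi.add_apply, Nat.cast_add]
      calc (q i : ℕ∞) + n i ≤ q i + (P.dW a.1.1 i - q i) := by gcongr
        _ = P.dW a.1.1 i := add_tsub_cancel_of_le (hq i)
    have hss : P.shift (p + n) a.1.1 = P.shift (q + n) a.1.1 := by
      rw [← P.shift_shift _ _ _ hN, ← P.shift_shift _ _ _ hN', hs]
    set v := P.rW (P.shift (p + n) a.1.1) with hv
    have hvv : Λ.deg v = 0 := P.rW_vertex _
    have he : P.rW (P.ofPath v) = v := by rw [P.rW_ofPath, Λ.rng_vertex _ hvv]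
    have hde : P.dW (P.ofPath v) = 0 := by rw [P.dW_ofPath, hvv]; funext i; simp
    have s1 : Λ.src (P.seg a.1.1 (p + n)) = P.rW (P.ofPath v) := by
      rw [he, hv, P.rW_shift _ _ hN]
    have s2 : Λ.src (P.seg a.1.1 (q + n)) = P.rW (P.ofPath v) := by
      rw [he, hv, hss, P.rW_shift _ _ hN']
    have D1 : P.dW (P.cons (P.seg a.1.1 (p + n)) (P.ofPath v)) =
        fun i => (((p + n) i : ℕ) : ℕ∞) := by
      rw [P.dW_cons _ _ s1, hde, P.seg_deg _ _ hN]; funext i; simp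
    have D2 : P.dW (P.cons (P.seg a.1.1 (q + n)) (P.ofPath v)) =
        fun i => (((q + n) i : ℕ) : ℕ∞) := by
      rw [P.dW_cons _ _ s2, hde, P.seg_deg _ _ hN']; funext i; simp
    have hdeg : ∀ i, (((p + n) i : ℕ) : ℤ) - (((q + n) i : ℕ) : ℤ) = a.1.2.1 i := by
      intro i; rw [← hpq i]; simp
    have hmor : IsMor Λ P (P.cons (P.seg a.1.1 (p + n)) (P.ofPath v), a.1.2.1,
        P.cons (P.seg a.1.1 (q + n)) (P.ofPath v)) := by
      refine ⟨p + n, q + n, fun i => ?_, fun i => ?_, hdeg, ?_⟩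
      · simp only [D1]; exact le_rfl
      · simp only [D2]; exact le_rfl
      · have t1 := P.shift_cons _ _ s1
        have t2 := P.shift_cons _ _ s2
        rw [P.seg_deg _ _ hN] at t1
        rw [P.seg_deg _ _ hN'] at t2
        exact t1.trans t2.symm
    have hb := interior_subset (hA' (p + n) (q + n) hAN hN hdeg (P.ofPath v)
      ⟨_, hmor⟩ he hde rfl rfl rfl)
    have hb' : P.cons (P.seg a.1.1 (p + n)) (P.ofPath v) =
      P.cons (P.seg a.1.1 (q + n)) (P.ofPath v) := hb
    rw [hb', D2] at D1
    funext i
    have e1 := congrFun D1 i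
    have e2 : (q + n) i = (p + n) i := by exact_mod_cast e1
    rw [← hdeg i, e2]; simp
  · rintro a ⟨haa, h0⟩
    have hvd : Λ.deg (P.rW a.1.1) = 0 := P.rW_vertex _
    refine mem_interior.2 ⟨TZ Λ P (P.rW a.1.1) (P.rW a.1.1) ∅, ?_, ?_, ?_⟩
    · rintro b ⟨z, -, h1, h2, -⟩
      exact h1.trans h2.symm
    · exact TopologicalSpace.isOpen_generateFrom_of_mem
        ⟨_, _, ∅, rfl, by simp, rfl⟩
    · refine ⟨a.1.1, Λ.src_vertex _ hvd, ?_, ?_, ?_, by simp⟩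
      · exact (P.cons_vertex _ _ hvd rfl).symm
      · rw [← haa]; exact (P.cons_vertex _ _ hvd rfl).symm
      · intro i; rw [h0]; simp
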